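/- arXiv:1012.6035 — 3 statements merged into one kernel-verified Lean document; each statement's English description precedes it below -/
import Mathlib

section
/- The Toffoli gate is universal for reversible computation: for every m and every permutation f of (Fin m → Bool), there exist a number r of ancilla wires, fixed ancilla values a : Fin r → Bool, and a finite list of Toffoli gates on the wire set Fin m ⊕ Fin r (each gate specified by three pairwise distinct wires i, j, k and acting on a bit assignment by replacing the bit at k with xor of that bit and the conjunction of the bits at i and j, leaving all other bits unchanged) such that the composition g of this list of gates satisfies g (Sum.elim x a) = Sum.elim (f x) a for every x : Fin m → Bool. -/
/-- The Toffoli gate with controls `i, j` and target `k`: it replaces the bit at `k`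
by its xor with the conjunction of the bits at `i` and `j`. -/
def toffoli {W : Type*} [DecidableEq W] (i j k : W) (x : W → Bool) : W → Bool :=
  fun w => if w = k then xor (x k) (x i && x j) else x w

/-- `F` is a composition of Toffoli gates, each acting on three distinct wires. -/
def IsToffoliCircuit {W : Type*} [DecidableEq W] (F : (W → Bool) → W → Bool) : Prop :=
  ∃ L : List (W × W × W), (∀ t ∈ L, t.1 ≠ t.2.1 ∧ t.1 ≠ t.2.2 ∧ t.2.1 ≠ t.2.2) ∧
    (L.map fun t => toffoli t.1 t.2.1 t.2.2).foldr (· ∘ ·) id = F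

/-- The map replacing the bit at `k` by its xor with `g`. -/
def controlledFlip {W : Type*} [DecidableEq W] (g : (W → Bool) → Bool) (k : W)
    (x : W → Bool) : W → Bool :=
  Function.update x k (xor (x k) (g x))

section Circuits

variable {W : Type*} [DecidableEq W]

theorem IsToffoliCircuit.id : IsToffoliCircuit (id : (W → Bool) → W → Bool) :=
  ⟨[], by simp, rfl⟩

theorem IsToffoliCircuit.comp {F G : (W → Bool) → W → Bool} (hF : IsToffoliCircuit F)
    (hG : IsToffoliCircuit G) : IsToffoliCircuit (F ∘ G) := by
  obtain ⟨L, hL, rfl⟩ := hF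
  obtain ⟨M, hM, rfl⟩ := hG
  refine ⟨L ++ M, fun t ht => (List.mem_append.1 ht).elim (hL t) (hM t), ?_⟩
  clear hL hM
  induction L with
  | nil => rfl
  | cons t L ih =>
    simp only [List.cons_append, List.map_cons, List.foldr_cons, ih]
    rfl

theorem isToffoliCircuit_controlledFlip_and {i j k : W} (hij : i ≠ j) (hik : i ≠ k)
    (hjk : j ≠ k) : IsToffoliCircuit (controlledFlip (fun x => x i && x j) k) := by
  refine ⟨[(i, j, k)], by simp [hij, hik, hjk], ?_⟩
  funext x w
  simp [toffoli, controlledFlip, Function.update_apply]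

theorem controlledFlip_comp_controlledFlip {g h : (W → Bool) → Bool} {k : W}
    (hg : ∀ x b, g (Function.update x k b) = g x) :
    controlledFlip g k ∘ controlledFlip h k = controlledFlip (fun x => xor (h x) (g x)) k := by
  funext x
  simp [controlledFlip, hg]

/-- Conjunction of controls through a borrowed wire `z`, whose bit is arbitrary. -/
theorem controlledFlip_commutator {g h : (W → Bool) → Bool} {k z : W} (hzk : z ≠ k)
    (hgk : ∀ x b, g (Function.update x k b) = g x)
    (hgz : ∀ x b, g (Function.update x z b) = g x)
    (hhk : ∀ x b, h (Function.update x k b) = h x)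
    (hhz : ∀ x b, h (Function.update x z b) = h x) :
    controlledFlip (fun x => x z && h x) k ∘ controlledFlip g z ∘
      controlledFlip (fun x => x z && h x) k ∘ controlledFlip g z =
      controlledFlip (fun x => g x && h x) k := by
  funext x w
  by_cases hwk : w = k
  · subst hwk
    simp only [controlledFlip, Function.comp_apply, Function.update_self, hgk, hgz, hhk, hhz,
      Function.update_of_ne hzk, Function.update_of_ne hzk.symm]
    cases x w <;> cases x z <;> cases g x <;> cases h x <;> rfl
  · by_cases hwz : w = z
    · subst hwz
      simp [controlledFlip, hgk, hgz, hzk]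
    · simp [controlledFlip, hwk, hwz]

/-- A bit flip controlled by two wires `p`, `q` holding `1` and by the wires in `T` holding the
pattern `b`, built with one borrowed wire `d`. -/
theorem isToffoliCircuit_controlledFlip_pattern {p q : W} (hpq : p ≠ q) (b : W → Bool)
    (T : Finset W) : ∀ {k d : W}, k ≠ d → k ≠ p → k ≠ q → d ≠ p → d ≠ q → k ∉ T → d ∉ T →
    IsToffoliCircuit
      (controlledFlip (fun x => x p && x q && decide (∀ i ∈ T, x i = b i)) k) := by
  induction T using Finset.induction_on with
  | empty =>
    intro k d _ hkp hkq _ _ _ _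
    simpa using isToffoliCircuit_controlledFlip_and hpq hkp.symm hkq.symm
  | insert i T _ ih =>
    intro k d hkd hkp hkq hdp hdq hkT hdT
    simp only [Finset.mem_insert, not_or] at hkT hdT
    have invariant : ∀ w, w ≠ p → w ≠ q → w ∉ T → ∀ (x : W → Bool) (c : Bool),
        (fun x : W → Bool => x p && x q && decide (∀ i ∈ T, x i = b i)) (Function.update x w c) =
          (fun x : W → Bool => x p && x q && decide (∀ i ∈ T, x i = b i)) x := by
      intro w hwp hwq hwT x c
      have hT : ∀ j ∈ T, Function.update x w c j = x j := fun j hj =>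
        Function.update_of_ne (by rintro rfl; exact hwT hj) _ _
      simp +contextual [Function.update_of_ne hwp.symm, Function.update_of_ne hwq.symm, hT]
    have inner := ih hkd.symm hdp hdq hkp hkq hdT.2 hkT.2
    have literal : ∀ h : (W → Bool) → Bool, (∀ x c, h (Function.update x k c) = h x) →
        (∀ x c, h (Function.update x d c) = h x) →
        IsToffoliCircuit (controlledFlip (fun x => x d && h x) k) →
        IsToffoliCircuit (controlledFlip
          (fun x => (x p && x q && decide (∀ i ∈ T, x i = b i)) && h x) k) := by
      intro h hhk hhd hh
      rw [← controlledFlip_commutator hkd.symm (invariant k hkp hkq hkT.2)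
        (invariant d hdp hdq hdT.2) hhk hhd]
      exact hh.comp (inner.comp (hh.comp inner))
    have positive := isToffoliCircuit_controlledFlip_and hdT.1 hkd.symm (Ne.symm hkT.1)
    cases hb : b i with
    | true =>
      convert literal (fun x => x i) (by simp [Function.update_of_ne (Ne.symm hkT.1)])
        (by simp [Function.update_of_ne (Ne.symm hdT.1)]) positive using 3 with x
      by_cases hi : x i = true <;> simp [hb, hi]
    | false =>
      have negative : IsToffoliCircuit (controlledFlip (fun x => x d && xor (x p) (x i)) k) := by
        have := positive.comp (isToffoliCircuit_controlledFlip_and hdp hkd.symm hkp.symm)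
        rw [controlledFlip_comp_controlledFlip (by
          simp [Function.update_of_ne (Ne.symm hkT.1), Function.update_of_ne hkd.symm])] at this
        simpa only [← Bool.and_xor_distrib_left] using this
      convert literal (fun x => xor (x p) (x i))
        (by simp [Function.update_of_ne (Ne.symm hkT.1), Function.update_of_ne hkp.symm])
        (by simp [Function.update_of_ne (Ne.symm hdT.1), Function.update_of_ne hdp.symm])
        negative using 3 with x
      cases hp : x p <;> cases hi : x i <;> simp [hb, hi]

end Circuits

/-- The permutations of `V → Bool` realized by Toffoli circuits on `V ⊕ A` with the ancillas
in `A` holding `a`. -/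
def toffoliRealizable {V A : Type*} [DecidableEq V] [DecidableEq A] (a : A → Bool) :
    Submonoid (Equiv.Perm (V → Bool)) where
  carrier := {f | ∃ F, IsToffoliCircuit F ∧ ∀ x : V → Bool, F (Sum.elim x a) = Sum.elim (f x) a}
  one_mem' := ⟨id, .id, fun _ => rfl⟩
  mul_mem' := by
    rintro f g ⟨F, hF, hf⟩ ⟨G, hG, hg⟩
    exact ⟨F ∘ G, hF.comp hG, fun x => by simp [hf, hg]⟩

/-- The transpositions of assignments that differ in exactly one bit. -/
def neighborSwaps (V : Type*) [DecidableEq V] [Fintype V] : Set (Equiv.Perm (V → Bool)) :=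
  {f | ∃ x k, f = Equiv.swap x (Function.update x k (!x k))}

theorem closure_neighborSwaps (V : Type*) [DecidableEq V] [Fintype V] :
    Subgroup.closure (neighborSwaps V) = ⊤ := by
  have orbit_update : ∀ (x : V → Bool) k b, Function.update x k b ∈
      MulAction.orbit (Subgroup.closure (neighborSwaps V)) x := by
    intro x k b
    by_cases hb : b = x k
    · subst hb
      simp
    · obtain rfl : b = !x k := Bool.eq_not_iff.2 hb
      exact ⟨⟨_, Subgroup.subset_closure ⟨x, k, rfl⟩⟩, Equiv.swap_apply_left _ _⟩
  have orbit_piecewise : ∀ (x y : V → Bool) (T : Finset V), T.piecewise y x ∈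
      MulAction.orbit (Subgroup.closure (neighborSwaps V)) x := by
    intro x y T
    induction T using Finset.induction_on with
    | empty => simp
    | insert k T _ ih =>
      rw [Finset.piecewise_insert, ← MulAction.orbit_eq_iff.2 ih]
      exact orbit_update _ _ _
  have : MulAction.IsPretransitive (Subgroup.closure (neighborSwaps V)) (V → Bool) :=
    ⟨fun x y => MulAction.mem_orbit_iff.1
      (Finset.piecewise_univ (f := y) (g := x) ▸ orbit_piecewise x y Finset.univ)⟩
  refine closure_of_isSwap_of_isPretransitive ?_
  rintro _ ⟨x, k, rfl⟩
  exact ⟨x, _, fun h => by simpa using congrFun h k, rfl⟩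

theorem neighborSwaps_subset_toffoliRealizable {V A : Type*} [DecidableEq V] [Fintype V]
    [DecidableEq A] {a : A → Bool} {p q d : A} (hpq : p ≠ q) (hdp : d ≠ p) (hdq : d ≠ q)
    (hp : a p = true) (hq : a q = true) :
    neighborSwaps V ⊆ (toffoliRealizable a : Submonoid (Equiv.Perm (V → Bool))) := by
  rintro _ ⟨x, k, rfl⟩
  refine ⟨_, isToffoliCircuit_controlledFlip_pattern (p := .inr p) (q := .inr q)
    (k := .inl k) (d := .inr d) (by simpa using hpq) (Sum.elim x a)
    ((Finset.univ.erase k).map Function.Embedding.inl) (by simp) (by simp) (by simp)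
    (by simpa using hdp) (by simpa using hdq) (by simp) (by simp), fun y => ?_⟩
  simp only [controlledFlip, Sum.elim_inl, Sum.elim_inr, hp, hq, Sum.update_elim_inl,
    Finset.mem_map, Finset.mem_erase, Finset.mem_univ, Function.Embedding.inl_apply,
    forall_exists_index, and_imp, forall_apply_eq_imp_iff₂, and_true, Bool.true_and]
  congr 1
  by_cases hy : ∀ i, i ≠ k → y i = x i
  · have hyx : y = Function.update x k (y k) := by
      funext i
      by_cases hi : i = k
      · subst hi; simp
      · simp [hi, hy i hi]
    by_cases hk : y k = x k
    · obtain rfl : y = x := by simpa [hk] using hyx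
      simp
    · have hk' : y k = !x k := Bool.eq_not_iff.2 hk
      rw [hk'] at hyx
      subst hyx
      simp +contextual
  · rw [Equiv.swap_apply_of_ne_of_ne]
    · simp [hy]
    · rintro rfl
      exact hy fun _ _ => rfl
    · rintro rfl
      exact hy fun i hi => Function.update_of_ne hi _ _

/-- The Toffoli gate is universal for reversible computation: every permutation of the
bit assignments on `m` wires is realized by a finite list of Toffoli gates (on the `m`
wires together with `r` ancilla wires holding fixed values `a`, which are restored at
the end). -/
theorem toffoli_universal (m : ℕ) (f : Equiv.Perm (Fin m → Bool)) :
    ∃ (r : ℕ) (a : Fin r → Bool)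
      (L : List ((Fin m ⊕ Fin r) × (Fin m ⊕ Fin r) × (Fin m ⊕ Fin r))),
      (∀ t ∈ L, t.1 ≠ t.2.1 ∧ t.1 ≠ t.2.2 ∧ t.2.1 ≠ t.2.2) ∧
      ∀ x : Fin m → Bool,
        (L.map fun t => toffoli t.1 t.2.1 t.2.2).foldr (· ∘ ·) id (Sum.elim x a)
          = Sum.elim (f x) a := by
  have hle : Submonoid.closure (neighborSwaps (Fin m)) ≤
      toffoliRealizable (![true, true, false] : Fin 3 → Bool) :=
    Submonoid.closure_le.2 <| neighborSwaps_subset_toffoliRealizable (p := 0) (q := 1) (d := 2)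
      (by decide) (by decide) (by decide) rfl rfl
  have hf : f ∈ Submonoid.closure (neighborSwaps (Fin m)) := by
    rw [← Subgroup.closure_toSubmonoid_of_finite, closure_neighborSwaps]
    trivial
  obtain ⟨_, ⟨L, hL, rfl⟩, h⟩ := hle hf
  exact ⟨3, _, L, hL, h⟩
end

section
/- The set of gates consisting of all one-qubit gates together with the CNOT gates is universal for quantum circuits: for every n ≥ 2, the subgroup of the unitary group of complex matrices indexed by (Fin n → Bool) generated by (a) all single-qubit gates, i.e. for each wire i and each unitary 2×2 complex matrix u, the matrix whose entry at (x, y) equals u (x i) (y i) if x and y agree at all coordinates other than i and equals 0 otherwise, and (b) all CNOT gates, i.e. for each pair of distinct wires i ≠ j, the permutation matrix of the bijection of (Fin n → Bool) sending x to the assignment agreeing with x except that the bit at j becomes xor (x j) (x i), is the entire unitary group. -/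
/-- The single-qubit gate `u` acting on wire `i` of `n` qubits: its entry at `(x, y)`
is `u (x i) (y i)` if `x` and `y` agree at all coordinates other than `i`, and `0`
otherwise. -/
noncomputable def oneQubitGateMatrix (n : ℕ) (i : Fin n) (u : Matrix Bool Bool ℂ) :
    Matrix (Fin n → Bool) (Fin n → Bool) ℂ :=
  Matrix.of fun x y => if ∀ j, j ≠ i → x j = y j then u (x i) (y i) else 0

/-- The CNOT bijection on basis states with control `i` and target `j`: the bit at `j`
becomes `xor (x j) (x i)`. -/
def cnotFun (n : ℕ) (i j : Fin n) (x : Fin n → Bool) : Fin n → Bool :=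
  fun w => if w = j then xor (x j) (x i) else x w

/-- The permutation matrix of the CNOT bijection. -/
noncomputable def cnotMatrix (n : ℕ) (i j : Fin n) :
    Matrix (Fin n → Bool) (Fin n → Bool) ℂ :=
  Matrix.of fun x y => if cnotFun n i j y = x then 1 else 0

/-- A two-component vector can be rotated by a unitary matrix onto the axis `false`. -/
theorem exists_unitary_mulVec_true_eq_zero (p : Bool → ℂ) :
    ∃ w : Matrix.unitaryGroup Bool ℂ, (w.1.mulVec p) true = 0 := by
  by_cases hp : p = 0
  · exact ⟨1, by simp [hp]⟩
  set r : ℝ := ‖p false‖ ^ 2 + ‖p true‖ ^ 2 with hr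
  have hpos : 0 < r := by
    by_contra! h
    have h0 : ‖p false‖ = 0 := by nlinarith [sq_nonneg ‖p false‖, sq_nonneg ‖p true‖]
    have h1 : ‖p true‖ = 0 := by nlinarith [sq_nonneg ‖p false‖, sq_nonneg ‖p true‖]
    exact hp (funext fun b => by cases b <;> simp_all)
  have hs : ((√r : ℝ) : ℂ) * (√r : ℝ) = r := by
    rw [← Complex.ofReal_mul, Real.mul_self_sqrt hpos.le]
  have hs0 : ((√r : ℝ) : ℂ) ≠ 0 := by
    exact_mod_cast (Real.sqrt_pos.2 hpos).ne'
  have hrC : (r : ℂ) = p false * starRingEnd ℂ (p false) + p true * starRingEnd ℂ (p true) := by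
    rw [Complex.mul_conj', Complex.mul_conj', hr]; push_cast; ring
  refine ⟨⟨Matrix.of fun a b => (if a then (if b then p false else -p true)
    else star (p b)) / (√r : ℝ), ?_⟩, ?_⟩
  · rw [Matrix.mem_unitaryGroup_iff]
    ext a b
    cases a <;> cases b <;>
      simp [Matrix.mul_apply, Matrix.star_apply] <;> field_simp <;>
      first | ring1 | linear_combination -hrC - hs
  · simp [Matrix.mulVec, dotProduct]
    ring

/-- The unitary diagonal matrix with entries `d`. -/
noncomputable def diagonalUnitary {ι : Type*} [Fintype ι] [DecidableEq ι] (d : ι → Circle) :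
    Matrix.unitaryGroup ι ℂ :=
  ⟨Matrix.diagonal fun x => (d x : ℂ), by
    rw [Matrix.mem_unitaryGroup_iff, Matrix.star_eq_conjTranspose,
      Matrix.diagonal_conjTranspose, Matrix.diagonal_mul_diagonal, ← Matrix.diagonal_one]
    congr 1
    ext x
    simp [Complex.mul_conj]⟩

/-- The Pauli matrix `X`. -/
def pauliX : Matrix.unitaryGroup Bool ℂ :=
  ⟨Matrix.of fun a b => if a = b then 0 else 1, by
    rw [Matrix.mem_unitaryGroup_iff]
    ext a b
    cases a <;> cases b <;> simp [Matrix.mul_apply, Matrix.star_apply]⟩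

theorem Circle.exists_mul_self_eq (z : Circle) : ∃ y : Circle, y * y = z :=
  ⟨Circle.exp (Complex.arg z / 2), by rw [← Circle.exp_add, add_halves, Circle.exp_arg]⟩

/-- Every diagonal `2 × 2` unitary is a scalar multiple of a commutator with `X`. -/
theorem exists_diagonalUnitary_eq_mul_commutator (d : Bool → Circle) :
    ∃ (z : Circle) (a : Matrix.unitaryGroup Bool ℂ),
      diagonalUnitary d = diagonalUnitary (fun _ => z) * (a * pauliX * a⁻¹ * pauliX⁻¹) := by
  obtain ⟨r, hr⟩ := Circle.exists_mul_self_eq (d false * d true)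
  obtain ⟨y, hy⟩ := Circle.exists_mul_self_eq (d false * r⁻¹)
  refine ⟨r, diagonalUnitary (fun b => if b then y⁻¹ else y), ?_⟩
  have hd0 : d false = r * (y * y) := by rw [hy]; simp
  have hd1 : d true = r * (y * y)⁻¹ := by
    rw [hy, mul_inv, inv_inv, mul_left_comm, hr]; simp
  rw [← mul_assoc, eq_mul_inv_iff_mul_eq, ← mul_assoc,
    eq_mul_inv_iff_mul_eq]
  ext a b
  have hy0 : (y : ℂ) ≠ 0 := y.coe_ne_zero
  cases a <;> cases b <;>
    simp [diagonalUnitary, pauliX, Matrix.mul_apply, Matrix.diagonal_apply, hd0, hd1] <;>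
    field_simp

/-- A unitary matrix fixing a basis vector, on the left as a column, fixes it as a row. -/
theorem Matrix.unitaryGroup.row_eq_zero_of_col {ι : Type*} [Fintype ι] [DecidableEq ι]
    (U : Matrix.unitaryGroup ι ℂ) {x : ι} (h : ∀ y, y ≠ x → U.1 y x = 0) {y : ι} (hy : y ≠ x) :
    U.1 x y = 0 := by
  have hU := Matrix.mem_unitaryGroup_iff'.1 U.2
  have h1 := congrFun (congrFun hU x) x
  have h2 := congrFun (congrFun hU x) y
  rw [Matrix.mul_apply, Finset.sum_eq_single x
    (fun b _ hb => by simp [Matrix.star_apply, h b hb]) (by simp)] at h1 h2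
  rw [Matrix.one_apply_eq] at h1
  rw [Matrix.one_apply_ne hy.symm] at h2
  exact (mul_eq_zero.1 h2).resolve_left (left_ne_zero_of_mul (h1.trans_ne one_ne_zero))

theorem Matrix.unitaryGroup.apply_mem_unitSphere_of_col {ι : Type*} [Fintype ι] [DecidableEq ι]
    (U : Matrix.unitaryGroup ι ℂ) {x : ι} (h : ∀ y, y ≠ x → U.1 y x = 0) :
    U.1 x x ∈ Submonoid.unitSphere ℂ := by
  have h1 := congrFun (congrFun (Matrix.mem_unitaryGroup_iff'.1 U.2) x) x
  rw [Matrix.mul_apply, Finset.sum_eq_single x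
    (fun b _ hb => by simp [h b hb]) (by simp), Matrix.one_apply_eq,
    Matrix.star_apply, Complex.star_def, Complex.conj_mul'] at h1
  have h2 : ‖U.1 x x‖ ^ 2 = 1 := by exact_mod_cast h1
  rw [Submonoid.unitSphere, Submonoid.mem_mk]
  simpa using (pow_eq_one_iff_of_nonneg (norm_nonneg _) two_ne_zero).1 h2

/-- A unitary matrix that is diagonal is of the form `diagonalUnitary d`. -/
theorem exists_eq_diagonalUnitary {ι : Type*} [Fintype ι] [DecidableEq ι]
    (U : Matrix.unitaryGroup ι ℂ) (h : ∀ x y, x ≠ y → U.1 x y = 0) :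
    ∃ d, U = diagonalUnitary d := by
  refine ⟨fun x => ⟨U.1 x x,
    Matrix.unitaryGroup.apply_mem_unitSphere_of_col U fun y hy => h y x hy⟩, ?_⟩
  ext x y
  by_cases hxy : x = y
  · subst hxy
    simp [diagonalUnitary]
  · simp [diagonalUnitary, hxy, h x y hxy]

/-- A normal subgroup of the `2 × 2` unitary matrices containing the diagonal ones is everything. -/
theorem eq_top_of_normal_of_diagonalUnitary_mem (G : Subgroup (Matrix.unitaryGroup Bool ℂ))
    (hG : G.Normal) (hD : ∀ d, diagonalUnitary d ∈ G) : G = ⊤ := by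
  rw [eq_top_iff]
  rintro u -
  obtain ⟨μ, hμ⟩ := Module.End.exists_eigenvalue (Matrix.toLin' u.1)
  obtain ⟨v, hv⟩ := hμ.exists_hasEigenvector
  have huv : u.1.mulVec v = μ • v := by simpa using hv.apply_eq_smul
  obtain ⟨w, hw⟩ := exists_unitary_mulVec_true_eq_zero v
  have hww : w⁻¹.1 * w.1 = 1 := Matrix.mem_unitaryGroup_iff'.1 w.2
  have hw0 : (w.1.mulVec v) false ≠ 0 := by
    intro h0
    have h1 : w.1.mulVec v = 0 := funext fun b => by cases b <;> assumption
    apply hv.2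
    rw [← Matrix.one_mulVec v, ← hww, ← Matrix.mulVec_mulVec, h1, Matrix.mulVec_zero]
  have hc : (w * u * w⁻¹).1.mulVec (w.1.mulVec v) = μ • w.1.mulVec v := by
    rw [Matrix.UnitaryGroup.mul_val, Matrix.UnitaryGroup.mul_val, Matrix.mulVec_mulVec,
      Matrix.mul_assoc, hww, Matrix.mul_one, ← Matrix.mulVec_mulVec, huv, Matrix.mulVec_smul]
  have hcol : (w * u * w⁻¹).1 true false = 0 := by
    have := congrFun hc true
    rw [Matrix.mulVec, dotProduct, Fintype.sum_bool, Pi.smul_apply, hw, mul_zero, zero_add,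
      smul_zero] at this
    exact (mul_eq_zero.1 this).resolve_right hw0
  have hrow : (w * u * w⁻¹).1 false true = 0 :=
    Matrix.unitaryGroup.row_eq_zero_of_col _ (by simpa using hcol) (by simp)
  obtain ⟨d, hd⟩ := exists_eq_diagonalUnitary (w * u * w⁻¹) (by
    rintro (_ | _) (_ | _) h <;> first | exact absurd rfl h | assumption)
  have := hG.conj_mem _ (hD d) w⁻¹
  rw [← hd] at this
  simpa [mul_assoc] using this

/-- The embedding of `Bool` with values `s` and `t`. -/
def pairEmbedding {ι : Type*} {s t : ι} (h : s ≠ t) : Bool ↪ ι :=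
  ⟨fun b => if b then t else s, by
    rintro (_ | _) (_ | _) hab <;> simp_all [h.symm]⟩

@[simp]
theorem pairEmbedding_false {ι : Type*} {s t : ι} (h : s ≠ t) : pairEmbedding h false = s := rfl

@[simp]
theorem pairEmbedding_true {ι : Type*} {s t : ι} (h : s ≠ t) : pairEmbedding h true = t := rfl

section TwoLevel

variable {ι : Type*} [Fintype ι] [DecidableEq ι]

/-- The isometry sending the basis vector `b` of `ℂ²` to the basis vector `e b`. -/
def basisInclusion (e : Bool ↪ ι) : Matrix ι Bool ℂ :=
  Matrix.of fun x b => if x = e b then 1 else 0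

theorem conjTranspose_basisInclusion_mul_self (e : Bool ↪ ι) :
    (basisInclusion e).conjTranspose * basisInclusion e = 1 := by
  ext a b
  simp [basisInclusion, Matrix.mul_apply, Matrix.one_apply, eq_comm]

theorem conjTranspose_basisInclusion_mulVec (e : Bool ↪ ι) (v : ι → ℂ) :
    (basisInclusion e).conjTranspose.mulVec v = v ∘ e := by
  ext a
  simp [basisInclusion, Matrix.mulVec, dotProduct]

/-- The two-level unitary acting as `u` on the basis vectors in the range of `e`, and trivially
on all others. -/
def twoLevel (e : Bool ↪ ι) (u : Matrix.unitaryGroup Bool ℂ) : Matrix.unitaryGroup ι ℂ :=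
  ⟨1 + basisInclusion e * (u.1 - 1) * (basisInclusion e).conjTranspose, by
    have hE := conjTranspose_basisInclusion_mul_self e
    have hu : u.1 * u.1.conjTranspose = 1 := Matrix.mem_unitaryGroup_iff.1 u.2
    rw [Matrix.mem_unitaryGroup_iff, Matrix.star_eq_conjTranspose]
    simp only [Matrix.conjTranspose_add, Matrix.conjTranspose_mul, Matrix.conjTranspose_sub,
      Matrix.conjTranspose_one, Matrix.conjTranspose_conjTranspose]
    set E := basisInclusion e
    have h : E * (u.1 - 1) * E.conjTranspose * (E * ((u.1.conjTranspose - 1) * E.conjTranspose)) =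
        E * ((u.1 - 1) * (u.1.conjTranspose - 1)) * E.conjTranspose := by
      calc _ = E * (u.1 - 1) * (E.conjTranspose * E) *
            ((u.1.conjTranspose - 1) * E.conjTranspose) := by simp only [Matrix.mul_assoc]
        _ = _ := by rw [hE]; simp only [Matrix.mul_assoc, Matrix.mul_one]
    have h' : (u.1 - 1) * (u.1.conjTranspose - 1) = -(u.1 - 1) - (u.1.conjTranspose - 1) := by
      rw [sub_mul, mul_sub, hu]; simp only [mul_one, one_mul]; abel
    rw [add_mul, one_mul, mul_add, mul_one, h, h']
    simp only [Matrix.mul_sub, Matrix.sub_mul, Matrix.mul_neg, Matrix.neg_mul, Matrix.mul_one,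
      Matrix.one_mul, Matrix.mul_assoc]
    abel⟩

theorem twoLevel_mulVec_apply (e : Bool ↪ ι) (u : Matrix.unitaryGroup Bool ℂ) (v : ι → ℂ)
    (b : Bool) : (twoLevel e u).1.mulVec v (e b) = u.1.mulVec (v ∘ e) b := by
  have h : (basisInclusion e).conjTranspose * (twoLevel e u).1 =
      u.1 * (basisInclusion e).conjTranspose := by
    rw [twoLevel, Matrix.mul_add, Matrix.mul_one, ← Matrix.mul_assoc, ← Matrix.mul_assoc,
      conjTranspose_basisInclusion_mul_self, Matrix.one_mul, Matrix.sub_mul, Matrix.one_mul]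
    abel
  rw [← conjTranspose_basisInclusion_mulVec, Matrix.mulVec_mulVec, ← h, ← Matrix.mulVec_mulVec,
    conjTranspose_basisInclusion_mulVec, Function.comp_apply]

theorem twoLevel_mulVec_of_notMem_range (e : Bool ↪ ι) (u : Matrix.unitaryGroup Bool ℂ)
    (v : ι → ℂ) {x : ι} (hx : x ∉ Set.range e) : (twoLevel e u).1.mulVec v x = v x := by
  have hx' : ∀ b, x ≠ e b := fun b hb => hx ⟨b, hb.symm⟩
  rw [twoLevel, Matrix.add_mulVec, Matrix.one_mulVec, Matrix.mul_assoc, ← Matrix.mulVec_mulVec,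
    Pi.add_apply, add_eq_left, Matrix.mulVec, dotProduct]
  exact Finset.sum_eq_zero fun b _ => by simp [basisInclusion, hx' b]

theorem twoLevel_mulVec_eq_self (e : Bool ↪ ι) (u : Matrix.unitaryGroup Bool ℂ)
    (v : ι → ℂ) (hv : v ∘ e = 0) : (twoLevel e u).1.mulVec v = v := by
  ext x
  by_cases hx : x ∈ Set.range e
  · obtain ⟨b, rfl⟩ := hx
    rw [twoLevel_mulVec_apply, hv, Matrix.mulVec_zero]
    exact (congrFun hv b).symm
  · exact twoLevel_mulVec_of_notMem_range e u v hx

theorem twoLevel_mulVec_single (e : Bool ↪ ι) (u : Matrix.unitaryGroup Bool ℂ) {x : ι}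
    (hx : x ∉ Set.range e) : (twoLevel e u).1.mulVec (Pi.single x 1) = Pi.single x 1 :=
  twoLevel_mulVec_eq_self e u _ (funext fun b =>
    Pi.single_eq_of_ne (fun h => hx ⟨b, h⟩) _)

theorem twoLevel_diagonalUnitary_mulVec_single (e : Bool ↪ ι) (d : Bool → Circle) (b : Bool)
    (z : ℂ) : (twoLevel e (diagonalUnitary d)).1.mulVec (Pi.single (e b) z) =
      Pi.single (e b) (d b * z) := by
  ext y
  by_cases hy : y ∈ Set.range e
  · obtain ⟨c, rfl⟩ := hy
    rw [twoLevel_mulVec_apply]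
    by_cases hcb : c = b
    · subst hcb
      simp [diagonalUnitary, Matrix.mulVec_diagonal]
    · simp [diagonalUnitary, Matrix.mulVec_diagonal, hcb]
  · have hye : y ≠ e b := fun h => hy ⟨b, h.symm⟩
    rw [twoLevel_mulVec_of_notMem_range _ _ _ hy, Pi.single_eq_of_ne hye, Pi.single_eq_of_ne hye]

theorem conj_twoLevel {U : Matrix.unitaryGroup ι ℂ} {e f : Bool ↪ ι}
    (h : U.1 * basisInclusion e = basisInclusion f) (u : Matrix.unitaryGroup Bool ℂ) :
    U * twoLevel e u * U⁻¹ = twoLevel f u := by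
  rw [mul_inv_eq_iff_eq_mul]
  apply Subtype.ext
  have h' : (basisInclusion f).conjTranspose * U.1 = (basisInclusion e).conjTranspose := by
    rw [← h, Matrix.conjTranspose_mul, Matrix.mul_assoc, ← Matrix.star_eq_conjTranspose U.1,
      Matrix.mem_unitaryGroup_iff'.1 U.2, Matrix.mul_one]
  rw [Matrix.UnitaryGroup.mul_val, Matrix.UnitaryGroup.mul_val, twoLevel, twoLevel,
    Matrix.mul_add, Matrix.add_mul, Matrix.mul_one, Matrix.one_mul, Matrix.mul_assoc _ _ U.1, h',
    ← h]
  simp only [Matrix.mul_assoc]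

theorem twoLevel_pauliX_mul_basisInclusion (f e : Bool ↪ ι) :
    (twoLevel f pauliX).1 * basisInclusion e =
      basisInclusion (e.trans (Equiv.swap (f false) (f true)).toEmbedding) := by
  have key : ∀ y, (twoLevel f pauliX).1.mulVec (Pi.single y 1) =
      Pi.single (Equiv.swap (f false) (f true) y) 1 := by
    intro y
    by_cases hy : y ∈ Set.range f
    · obtain ⟨c, rfl⟩ := hy
      have hc : Equiv.swap (f false) (f true) (f c) = f (!c) := by cases c <;> simp
      rw [hc]
      ext x
      by_cases hx : x ∈ Set.range f
      · obtain ⟨b, rfl⟩ := hx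
        rw [twoLevel_mulVec_apply]
        cases b <;> cases c <;>
          simp [Matrix.mulVec, dotProduct, pauliX, Pi.single_apply]
      · rw [twoLevel_mulVec_of_notMem_range _ _ _ hx]
        have hx' : ∀ b, x ≠ f b := fun b hb => hx ⟨b, hb.symm⟩
        simp [hx']
    · rw [twoLevel_mulVec_single _ _ hy, Equiv.swap_apply_of_ne_of_ne] <;>
        exact fun h => hy ⟨_, h.symm⟩
  ext x b
  have hcol : (basisInclusion e).col b = Pi.single (e b) 1 := by
    ext y; simp [basisInclusion, Pi.single_apply, Matrix.col]
  have h := congrFun (key (e b)) x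
  rw [← hcol] at h
  refine h.trans ?_
  simp [basisInclusion, Pi.single_apply]

/-- All two-level unitaries on the pair `s`, `t` belong to `H` (vacuous if `s = t`). -/
def TwoLevelMem (H : Subgroup (Matrix.unitaryGroup ι ℂ)) (s t : ι) : Prop :=
  ∀ (h : s ≠ t) (u : Matrix.unitaryGroup Bool ℂ), twoLevel (pairEmbedding h) u ∈ H

theorem twoLevel_mem_of_swap {H : Subgroup (Matrix.unitaryGroup ι ℂ)} {e f g : Bool ↪ ι}
    (hf : twoLevel f pauliX ∈ H) (u : Matrix.unitaryGroup Bool ℂ) (he : twoLevel e u ∈ H)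
    (hg : ∀ b, g b = Equiv.swap (f false) (f true) (e b)) : twoLevel g u ∈ H := by
  have hg' : g = e.trans (Equiv.swap (f false) (f true)).toEmbedding :=
    DFunLike.ext _ _ hg
  rw [hg', ← conj_twoLevel (twoLevel_pauliX_mul_basisInclusion f e) u]
  exact H.mul_mem (H.mul_mem hf he) (H.inv_mem hf)

theorem TwoLevelMem.symm {H : Subgroup (Matrix.unitaryGroup ι ℂ)} {s t : ι}
    (h : TwoLevelMem H s t) : TwoLevelMem H t s := fun hts u =>
  twoLevel_mem_of_swap (h hts.symm pauliX) u (h hts.symm u) (by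
    rintro (_ | _) <;> simp)

theorem TwoLevelMem.trans {H : Subgroup (Matrix.unitaryGroup ι ℂ)} {s t r : ι}
    (h : TwoLevelMem H s t) (h' : TwoLevelMem H t r) : TwoLevelMem H s r := by
  intro hsr u
  by_cases hst : s = t
  · subst hst
    exact h' hsr u
  by_cases htr : t = r
  · subst htr
    exact h hsr u
  refine twoLevel_mem_of_swap (h' htr pauliX) u (h hst u) ?_
  rintro (_ | _)
  · simp [Equiv.swap_apply_of_ne_of_ne hst hsr]
  · simp

theorem exists_mem_mulVec_eq_zero {H : Subgroup (Matrix.unitaryGroup ι ℂ)}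
    (hH : ∀ s t, TwoLevelMem H s t) (a : ι) (v : ι → ℂ) (T : Finset ι) (ha : a ∉ T) :
    ∃ g ∈ H, (∀ x, x ∉ insert a T → g.1.mulVec (Pi.single x 1) = Pi.single x 1) ∧
      ∀ t ∈ T, g.1.mulVec v t = 0 := by
  induction T using Finset.induction_on with
  | empty => exact ⟨1, H.one_mem, fun x _ => Matrix.one_mulVec _, by simp⟩
  | insert t T ht ih =>
    rw [Finset.mem_insert, not_or] at ha
    obtain ⟨g, hg, hfix, hzero⟩ := ih ha.2
    obtain ⟨u, hu⟩ := exists_unitary_mulVec_true_eq_zero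
      (g.1.mulVec v ∘ pairEmbedding ha.1)
    have hrange : ∀ x, x ≠ a → x ≠ t → x ∉ Set.range (pairEmbedding ha.1) := by
      rintro x hxa hxt ⟨_ | _, rfl⟩
      · exact hxa rfl
      · exact hxt rfl
    refine ⟨twoLevel (pairEmbedding ha.1) u * g, H.mul_mem (hH _ _ _ _) hg, ?_, ?_⟩
    · intro x hx
      simp only [Finset.mem_insert, not_or] at hx
      rw [Matrix.UnitaryGroup.mul_val, ← Matrix.mulVec_mulVec, hfix x (by simp [hx]),
        twoLevel_mulVec_single _ _ (hrange x hx.1 hx.2.1)]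
    · intro s hs
      rw [Matrix.UnitaryGroup.mul_val, ← Matrix.mulVec_mulVec]
      by_cases hst : s = t
      · subst hst
        exact (twoLevel_mulVec_apply (pairEmbedding ha.1) u _ true).trans hu
      · have hsT : s ∈ T := (Finset.mem_insert.1 hs).resolve_left hst
        rw [twoLevel_mulVec_of_notMem_range _ _ _
          (hrange s (fun h => ha.2 (h ▸ hsT)) hst), hzero s hsT]

/-- Two-level unitaries generate the unitary group. -/
theorem eq_top_of_twoLevelMem [Nontrivial ι] {H : Subgroup (Matrix.unitaryGroup ι ℂ)}
    (hH : ∀ s t, TwoLevelMem H s t) : H = ⊤ := by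
  suffices key : ∀ (S : Finset ι) (U : Matrix.unitaryGroup ι ℂ),
      (∀ x, x ∉ S → U.1.mulVec (Pi.single x 1) = Pi.single x 1) → U ∈ H by
    rw [eq_top_iff]
    exact fun U _ => key Finset.univ U (by simp)
  intro S
  induction S using Finset.induction_on with
  | empty =>
    intro U hU
    have : U = 1 := by
      ext x y
      have := congrFun (hU y (by simp)) x
      rw [Matrix.mulVec_single_one] at this
      simpa [Matrix.one_apply, Pi.single_apply] using this
    exact this ▸ H.one_mem
  | insert a S ha ih =>
    intro U hU
    obtain ⟨g, hg, hfix, hzero⟩ :=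
      exists_mem_mulVec_eq_zero hH a (U.1.mulVec (Pi.single a 1)) S ha
    obtain ⟨t, hta⟩ := exists_ne a
    have hW : ∀ x, x ∉ insert a S → (g * U).1.mulVec (Pi.single x 1) = Pi.single x 1 := by
      intro x hx
      rw [Matrix.UnitaryGroup.mul_val, ← Matrix.mulVec_mulVec, hU x hx, hfix x hx]
    have hcol : ∀ y, y ≠ a → (g * U).1 y a = 0 := by
      intro y hy
      by_cases hyS : y ∈ S
      · have := hzero y hyS
        rwa [Matrix.mulVec_mulVec, Matrix.mulVec_single_one] at this
      · refine Matrix.unitaryGroup.row_eq_zero_of_col _ (fun z hz => ?_) hy.symm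
        have := congrFun (hW y (by simp [hy, hyS])) z
        rw [Matrix.mulVec_single_one, Pi.single_eq_of_ne hz] at this
        exact this
    let z : Circle := ⟨_, Matrix.unitaryGroup.apply_mem_unitSphere_of_col _ hcol⟩
    have hWa : (g * U).1.mulVec (Pi.single a 1) = Pi.single a (z : ℂ) := by
      ext y
      rw [Matrix.mulVec_single_one]
      by_cases hy : y = a
      · subst hy
        rw [Pi.single_eq_same]
        rfl
      · rw [Pi.single_eq_of_ne hy]
        exact hcol y hy
    let p := twoLevel (pairEmbedding hta.symm) (diagonalUnitary fun b => if b then 1 else z⁻¹)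
    have hp : p ∈ H := hH _ _ _ _
    have hpa : p.1.mulVec (Pi.single a (z : ℂ)) = Pi.single a 1 := by
      refine (twoLevel_diagonalUnitary_mulVec_single (pairEmbedding hta.symm) _ false _).trans ?_
      simp
    have hmem : p * (g * U) ∈ H := by
      refine ih _ fun x hx => ?_
      rw [Matrix.UnitaryGroup.mul_val, ← Matrix.mulVec_mulVec]
      by_cases hxa : x = a
      · rw [hxa, hWa, hpa]
      rw [hW x (by simp [hxa, hx])]
      by_cases hxt : x = t
      · rw [hxt]
        refine (twoLevel_diagonalUnitary_mulVec_single (pairEmbedding hta.symm) _ true _).trans ?_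
        simp
      · refine twoLevel_mulVec_single _ _ ?_
        rintro ⟨_ | _, rfl⟩
        · exact hxa rfl
        · exact hxt rfl
    exact (H.mul_mem_cancel_left hg).1 ((H.mul_mem_cancel_left hp).1 hmem)

end TwoLevel

section Circuits

variable {n : ℕ}

/-- The uniformly controlled gate applying `F k` to wire `i` when the other wires are in the
basis state `k`. -/
noncomputable def uniformlyControlled (i : Fin n) :
    (({j // j ≠ i} → Bool) → Matrix.unitaryGroup Bool ℂ) →*
      Matrix.unitaryGroup (Fin n → Bool) ℂ :=
  MonoidHom.mk' (fun F => ⟨(Matrix.blockDiagonal fun k => (F k).1).submatrix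
      (Equiv.funSplitAt i Bool) (Equiv.funSplitAt i Bool), by
    have h : (fun k => (F k).1 * (F k).1.conjTranspose) = 1 :=
      funext fun k => Matrix.mem_unitaryGroup_iff.1 (F k).2
    rw [Matrix.mem_unitaryGroup_iff, Matrix.star_eq_conjTranspose, Matrix.conjTranspose_submatrix,
      Matrix.blockDiagonal_conjTranspose, Matrix.submatrix_mul_equiv, ← Matrix.blockDiagonal_mul,
      h, Matrix.blockDiagonal_one, Matrix.submatrix_one_equiv]⟩) fun F G => by
    have h : (Matrix.blockDiagonal fun k => (F k).1 * (G k).1).submatrix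
        (Equiv.funSplitAt i Bool) (Equiv.funSplitAt i Bool) =
          (Matrix.blockDiagonal fun k => (F k).1).submatrix
            (Equiv.funSplitAt i Bool) (Equiv.funSplitAt i Bool) *
          (Matrix.blockDiagonal fun k => (G k).1).submatrix
            (Equiv.funSplitAt i Bool) (Equiv.funSplitAt i Bool) := by
      rw [Matrix.blockDiagonal_mul, Matrix.submatrix_mul_equiv]
    exact Subtype.ext h

theorem uniformlyControlled_apply (i : Fin n)
    (F : ({j // j ≠ i} → Bool) → Matrix.unitaryGroup Bool ℂ) (x y : Fin n → Bool) :
    (uniformlyControlled i F).1 x y =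
      if ∀ j, j ≠ i → x j = y j then (F fun j => x j).1 (x i) (y i) else 0 := by
  have h : ((fun j : {j // j ≠ i} => x j) = fun j : {j // j ≠ i} => y j) ↔
      ∀ j, j ≠ i → x j = y j := by
    simp [funext_iff]
  calc _ = if (fun j : {j // j ≠ i} => x j) = fun j : {j // j ≠ i} => y j then
        (F fun j => x j).1 (x i) (y i) else 0 := rfl
    _ = _ := if_congr h rfl rfl

/-- The gate applying `u` to wire `i` when every wire `s ∈ S` other than `i` is in state `c s`. -/
noncomputable def multiControlled (i : Fin n) (S : Finset (Fin n)) (c : Fin n → Bool) :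
    Matrix.unitaryGroup Bool ℂ →* Matrix.unitaryGroup (Fin n → Bool) ℂ :=
  (uniformlyControlled i).comp (MonoidHom.mk'
    (fun u k => if ∀ s : {j // j ≠ i}, s.1 ∈ S → k s = c s then u else 1) fun u v => by
      ext1 k
      simp only [Pi.mul_apply]
      split_ifs <;> simp)

theorem multiControlled_eq (i : Fin n) (S : Finset (Fin n)) (c : Fin n → Bool)
    (u : Matrix.unitaryGroup Bool ℂ) : multiControlled i S c u = uniformlyControlled i
      (fun k => if ∀ s : {j // j ≠ i}, s.1 ∈ S → k s = c s then u else 1) := rfl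

theorem multiControlled_insert_scalar {i j : Fin n} (hij : i ≠ j) {S : Finset (Fin n)}
    (hi : i ∉ S) (hj : j ∉ S) (c : Fin n → Bool) (z : Circle) :
    multiControlled i (insert j S) c (diagonalUnitary fun _ => z) =
      multiControlled j S c (diagonalUnitary fun b => if b = c j then z else 1) := by
  have h1 : ∀ x : Fin n → Bool, (∀ s : {s // s ≠ i}, s.1 ∈ insert j S → x s = c s) ↔
      x j = c j ∧ ∀ s ∈ S, x s = c s := by
    intro x
    constructor
    · intro h
      exact ⟨h ⟨j, hij.symm⟩ (by simp),
        fun s hs => h ⟨s, fun h => hi (h ▸ hs)⟩ (by simp [hs])⟩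
    · rintro ⟨h, h'⟩ ⟨s, _⟩ hs
      rcases Finset.mem_insert.1 hs with rfl | hs
      exacts [h, h' s hs]
  have h2 : ∀ x : Fin n → Bool, (∀ s : {s // s ≠ j}, s.1 ∈ S → x s = c s) ↔
      ∀ s ∈ S, x s = c s :=
    fun x => ⟨fun h s hs => h ⟨s, fun h => hj (h ▸ hs)⟩ hs, fun h s hs => h s hs⟩
  ext x y
  simp only [multiControlled_eq, uniformlyControlled_apply, h1, h2]
  by_cases hxy : x = y
  · subst hxy
    by_cases hS : ∀ s ∈ S, x s = c s
    · by_cases hxj : x j = c j <;> simp [if_pos hS, hxj, diagonalUnitary]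
    · simp [hS]
  · have key : ∀ (l : Fin n) (d : Bool → Circle) (p : Prop) [Decidable p],
        (if ∀ m, m ≠ l → x m = y m then
          (if p then diagonalUnitary d else 1 : Matrix.unitaryGroup Bool ℂ).1 (x l) (y l)
          else 0) = 0 := by
      intro l d p _
      split_ifs with h hp
      · have hl : x l ≠ y l := fun hl => hxy (funext fun m =>
          if hm : m = l then hm ▸ hl else h m hm)
        simp [diagonalUnitary, hl]
      · have hl : x l ≠ y l := fun hl => hxy (funext fun m =>
          if hm : m = l then hm ▸ hl else h m hm)
        simp [hl]
      · rfl
    rw [key, key]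

theorem multiControlled_insert_commutator (i j : Fin n) (S : Finset (Fin n)) (c : Fin n → Bool)
    (a b : Matrix.unitaryGroup Bool ℂ) :
    multiControlled i (insert j S) c (a * b * a⁻¹ * b⁻¹) =
      multiControlled i S c a * multiControlled i {j} c b * (multiControlled i S c a)⁻¹ *
        (multiControlled i {j} c b)⁻¹ := by
  simp only [multiControlled_eq, ← map_mul, ← map_inv]
  congr 1
  ext1 k
  simp only [Pi.mul_apply, Pi.inv_apply]
  have h : (∀ s : {s // s ≠ i}, s.1 ∈ insert j S → k s = c s) ↔
      (∀ s : {s // s ≠ i}, s.1 ∈ S → k s = c s) ∧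
        ∀ s : {s // s ≠ i}, s.1 ∈ ({j} : Finset (Fin n)) → k s = c s := by
    simp only [Finset.mem_insert, Finset.mem_singleton]
    exact ⟨fun h => ⟨fun s hs => h s (.inr hs), fun s hs => h s (.inl hs)⟩,
      fun h s hs => hs.elim (h.2 s) (h.1 s)⟩
  simp only [h]
  by_cases h1 : ∀ s : {s // s ≠ i}, s.1 ∈ S → k s = c s <;>
    by_cases h2 : ∀ s : {s // s ≠ i}, s.1 ∈ ({j} : Finset (Fin n)) → k s = c s
  · rw [if_pos h1, if_pos h2, if_pos ⟨h1, h2⟩]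
  · rw [if_pos h1, if_neg h2, if_neg fun h => h2 h.2]
    simp
  · rw [if_neg h1, if_pos h2, if_neg fun h => h1 h.1]
    simp
  · rw [if_neg h1, if_neg h2, if_neg fun h => h1 h.1]
    simp

theorem multiControlled_conj (i : Fin n) (S : Finset (Fin n)) (c : Fin n → Bool)
    (u w : Matrix.unitaryGroup Bool ℂ) :
    multiControlled i S c (w * u * w⁻¹) =
      uniformlyControlled i (fun _ => w) * multiControlled i S c u *
        (uniformlyControlled i fun _ => w)⁻¹ := by
  simp only [multiControlled_eq, ← map_mul, ← map_inv]
  congr 1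
  ext1 k
  simp only [Pi.mul_apply, Pi.inv_apply]
  split_ifs <;> group

theorem pauliX_mul_pauliX : pauliX * pauliX = 1 := by
  ext a b
  cases a <;> cases b <;> simp [pauliX, Matrix.mul_apply]

/-- One-qubit gates and CNOT gates generate all multiply controlled gates. -/
theorem multiControlled_mem {H : Subgroup (Matrix.unitaryGroup (Fin n → Bool) ℂ)}
    (hone : ∀ (i : Fin n) u, uniformlyControlled i (fun _ => u) ∈ H)
    (hcnot : ∀ (i j : Fin n) (hj : j ≠ i),
      uniformlyControlled i (fun k => if k ⟨j, hj⟩ then pauliX else 1) ∈ H)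
    (S : Finset (Fin n)) (i : Fin n) (hi : i ∉ S) (c : Fin n → Bool)
    (u : Matrix.unitaryGroup Bool ℂ) : multiControlled i S c u ∈ H := by
  induction S using Finset.induction_on generalizing i u with
  | empty => simpa [multiControlled_eq] using hone i u
  | insert j S hj ih =>
    rw [Finset.mem_insert, not_or] at hi
    have hX : multiControlled i {j} c pauliX ∈ H := by
      have h : ∀ k : {j // j ≠ i} → Bool,
          (∀ s : {j // j ≠ i}, s.1 ∈ ({j} : Finset (Fin n)) → k s = c s) ↔
            k ⟨j, Ne.symm hi.1⟩ = c j := by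
        intro k
        simp only [Finset.mem_singleton]
        exact ⟨fun h => h ⟨j, _⟩ rfl, by rintro h ⟨s, _⟩ rfl; exact h⟩
      simp only [multiControlled_eq, h]
      cases hc : c j
      · have hmul := H.mul_mem (hone i pauliX) (hcnot i j (Ne.symm hi.1))
        rw [← map_mul] at hmul
        convert hmul using 2
        ext1 k
        cases hk : k ⟨j, Ne.symm hi.1⟩ <;> simp [hk, pauliX_mul_pauliX]
      · exact hcnot i j (Ne.symm hi.1)
    have hG : (H.comap (multiControlled i (insert j S) c)).Normal := by
      refine ⟨fun u hu w => ?_⟩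
      rw [Subgroup.mem_comap, multiControlled_conj]
      exact H.mul_mem (H.mul_mem (hone i w) hu) (H.inv_mem (hone i w))
    have htop := eq_top_of_normal_of_diagonalUnitary_mem _ hG fun d => by
      obtain ⟨z, a, h⟩ := exists_diagonalUnitary_eq_mul_commutator d
      have ha := ih i hi.2 a
      rw [Subgroup.mem_comap, h, map_mul, multiControlled_insert_scalar hi.1 hi.2 hj,
        multiControlled_insert_commutator]
      exact H.mul_mem (ih j hj _) (H.mul_mem (H.mul_mem (H.mul_mem ha hX) (H.inv_mem ha))
        (H.inv_mem hX))
    exact Subgroup.mem_comap.1 (htop ▸ Subgroup.mem_top u)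

theorem Function.update_false_ne_update_true (x : Fin n → Bool) (i : Fin n) :
    Function.update x i false ≠ Function.update x i true := fun h => by
  simpa using congrFun h i

/-- The two-level unitaries on two basis states differing in wire `i` are the gates on `i`
controlled by all other wires. -/
theorem twoLevel_update_eq_multiControlled (x : Fin n → Bool) (i : Fin n)
    (u : Matrix.unitaryGroup Bool ℂ) :
    twoLevel (pairEmbedding (Function.update_false_ne_update_true x i)) u =
      multiControlled i (Finset.univ.erase i) x u := by
  set e := pairEmbedding (Function.update_false_ne_update_true x i)
  have he : ∀ b, e b = Function.update x i b := by rintro (_ | _) <;> rfl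
  have hmem : ∀ y, y ∈ Set.range e ↔ ∀ j, j ≠ i → y j = x j := by
    intro y
    constructor
    · rintro ⟨b, rfl⟩ j hj
      simp [he, hj]
    · intro h
      refine ⟨y i, ?_⟩
      rw [he]
      ext j
      by_cases hj : j = i
      · subst hj; simp
      · simp [hj, h j hj]
  have hcond : ∀ y : Fin n → Bool,
      (∀ s : {s // s ≠ i}, s.1 ∈ Finset.univ.erase i → y s = x s) ↔ y ∈ Set.range e := by
    intro y
    rw [hmem]
    exact ⟨fun h j hj => h ⟨j, hj⟩ (by simp [hj]), fun h s _ => h s s.2⟩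
  ext y z
  have hentry := Matrix.mulVec_single_one (twoLevel e u).1 z
  rw [multiControlled_eq, uniformlyControlled_apply]
  simp only [hcond]
  refine (congrFun hentry y).symm.trans ?_
  by_cases hy : y ∈ Set.range e
  · obtain ⟨b, rfl⟩ := hy
    rw [twoLevel_mulVec_apply]
    by_cases hz : z ∈ Set.range e
    · obtain ⟨c, rfl⟩ := hz
      have hc : (Pi.single (e c) 1 : (Fin n → Bool) → ℂ) ∘ e = Pi.single c 1 := by
        ext d; simp [Pi.single_apply]
      have hag : ∀ j, j ≠ i → e b j = e c j := fun j hj => by simp [he, hj]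
      rw [hc, Matrix.mulVec_single_one, if_pos hag, if_pos ⟨b, rfl⟩]
      simp [he, Matrix.col]
    · have hc : (Pi.single z 1 : (Fin n → Bool) → ℂ) ∘ e = 0 := by
        ext d; exact Pi.single_eq_of_ne (fun h => hz ⟨d, h⟩) _
      have hag : ¬ ∀ j, j ≠ i → e b j = z j := fun h => by
        refine hz ((hmem z).2 fun j hj => ?_)
        rw [← h j hj]
        simp [he, hj]
      rw [hc, Matrix.mulVec_zero, if_neg hag]
      rfl
  · rw [twoLevel_mulVec_of_notMem_range _ _ _ hy, if_neg hy]
    by_cases hyz : y = z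
    · subst hyz
      simp
    · rw [Pi.single_eq_of_ne hyz]
      split_ifs with h
      · have hi : y i ≠ z i := fun hi => hyz (funext fun j =>
          if hj : j = i then hj ▸ hi else h j hj)
        simp [hi]
      · rfl

theorem twoLevelMem_of_multiControlled_mem {H : Subgroup (Matrix.unitaryGroup (Fin n → Bool) ℂ)}
    (hH : ∀ (i : Fin n) c u, multiControlled i (Finset.univ.erase i) c u ∈ H)
    (x y : Fin n → Bool) : TwoLevelMem H x y := by
  have hflip : ∀ (x : Fin n → Bool) (i : Fin n),
      TwoLevelMem H x (Function.update x i (!x i)) := by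
    intro x i
    have h01 : TwoLevelMem H (Function.update x i false) (Function.update x i true) := by
      intro _ u
      rw [twoLevel_update_eq_multiControlled]
      exact hH i x u
    have hx : Function.update x i (x i) = x := by simp
    rcases Bool.eq_false_or_eq_true (x i) with hxi | hxi
    · rw [hxi] at hx ⊢
      rw [hx] at h01
      exact h01.symm
    · rw [hxi] at hx ⊢
      rw [hx] at h01
      exact h01
  have hadj : ∀ (x : Fin n → Bool) (i : Fin n) (b : Bool),
      TwoLevelMem H x (Function.update x i b) := by
    intro x i b hne u
    obtain rfl : b = !x i := by
      by_contra hb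
      exact hne (by simp [show b = x i by simpa using hb])
    exact hflip x i hne u
  suffices key : ∀ (D : Finset (Fin n)) (x : Fin n → Bool), (∀ j, j ∉ D → x j = y j) →
      TwoLevelMem H x y from key Finset.univ x (by simp)
  intro D
  induction D using Finset.induction_on with
  | empty => exact fun x h hne => absurd (funext fun j => h j (by simp)) hne
  | insert i D _ ih =>
    refine fun x h => (hadj x i (y i)).trans (ih _ fun j hj => ?_)
    by_cases hji : j = i
    · subst hji; simp
    · simp [hji, h j (by simp [hji, hj])]

end Circuits

/-- All one-qubit gates together with the CNOT gates are universal: for `n ≥ 2` the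
subgroup of the unitary group on `n` qubits generated by them is the whole unitary
group. -/
theorem oneQubit_cnot_universal (n : ℕ) (hn : 2 ≤ n) :
    Subgroup.closure
      { U : Matrix.unitaryGroup (Fin n → Bool) ℂ |
        (∃ (i : Fin n) (u : Matrix Bool Bool ℂ), u ∈ Matrix.unitaryGroup Bool ℂ ∧
          (U : Matrix (Fin n → Bool) (Fin n → Bool) ℂ) = oneQubitGateMatrix n i u) ∨
        (∃ i j : Fin n, i ≠ j ∧
          (U : Matrix (Fin n → Bool) (Fin n → Bool) ℂ) = cnotMatrix n i j) } = ⊤ := by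
  have : Nonempty (Fin n) := ⟨⟨0, by omega⟩⟩
  refine eq_top_of_twoLevelMem (twoLevelMem_of_multiControlled_mem fun i c u =>
    multiControlled_mem ?_ ?_ _ i (by simp) c u)
  · intro i u
    refine Subgroup.subset_closure (Or.inl ⟨i, u.1, u.2, ?_⟩)
    ext x y
    exact uniformlyControlled_apply i _ x y
  · intro i j hj
    refine Subgroup.subset_closure (Or.inr ⟨j, i, hj, ?_⟩)
    ext x y
    rw [uniformlyControlled_apply, cnotMatrix, Matrix.of_apply]
    have hiff : cnotFun n j i y = x ↔
        (∀ m, m ≠ i → x m = y m) ∧ x i = xor (y i) (y j) := by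
      constructor
      · rintro rfl
        exact ⟨fun m hm => by simp [cnotFun, hm], by simp [cnotFun]⟩
      · rintro ⟨h, h'⟩
        ext m
        by_cases hm : m = i
        · subst hm; simp [cnotFun, h']
        · simp [cnotFun, hm, h m hm]
    simp only [hiff]
    by_cases h : ∀ m, m ≠ i → x m = y m
    · simp only [if_pos h, and_iff_right h, h j hj]
      cases hj' : y j <;> cases hx : x i <;> cases hy : y i <;> simp [pauliX]
    · rw [if_neg h, if_neg (fun h' => h h'.1)]
end

section
/- Classical reversible gates acting on at most two bits are not universal: for n = 3, the subgroup of the permutation group of (Fin n → Bool) generated by all permutations that act on at most two wires is a proper subgroup; in particular, the Toffoli gate (the permutation sending x to the assignment agreeing with x except that the bit at wire 2 becomes xor (x 2) (x 0 && x 1)) does not belong to this subgroup. -/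
/-- The Toffoli gate on three wires: the bit at wire `2` becomes
`xor (x 2) (x 0 && x 1)`. -/
def toffoliFun : (Fin 3 → Bool) → (Fin 3 → Bool) :=
  fun x w => if w = 2 then xor (x 2) (x 0 && x 1) else x w

theorem toffoliFun_involutive : Function.Involutive toffoliFun := by
  intro x; revert x; decide

/-- The Toffoli gate as a permutation of the bit assignments on three wires. -/
def toffoliPerm : Equiv.Perm (Fin 3 → Bool) :=
  Function.Involutive.toPerm toffoliFun toffoliFun_involutive

/-- A permutation of the assignments on three wires acts on at most two wires if there
are wires `i, j` and a bijection `h` of `Bool × Bool` through which it factors, leaving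
all other wires unchanged. -/
def ActsOnAtMostTwoWires (g : Equiv.Perm (Fin 3 → Bool)) : Prop :=
  ∃ (i j : Fin 3) (h : Bool × Bool ≃ Bool × Bool),
    ∀ x : Fin 3 → Bool,
      (∀ w, w ≠ i → w ≠ j → g x w = x w) ∧
      (g x i, g x j) = h (x i, x j)

/-- The subgroup of the permutations of `ι → Bool` that preserve wirewise `xor`s of three
assignments, that is, of the affine ones. -/
def affinePermSubgroup (ι : Type*) : Subgroup (Equiv.Perm (ι → Bool)) where
  carrier := {g | ∀ x y z : ι → Bool,
    g (fun w => x w ^^ y w ^^ z w) = fun w => g x w ^^ g y w ^^ g z w}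
  one_mem' _ _ _ := rfl
  mul_mem' {f g} hf hg x y z := by
    rw [Equiv.Perm.mul_apply, hg, hf]
    rfl
  inv_mem' {g} hg x y z := by
    rw [Equiv.Perm.inv_eq_iff_eq, hg]
    simp

theorem mem_affinePermSubgroup {ι : Type*} {g : Equiv.Perm (ι → Bool)} :
    g ∈ affinePermSubgroup ι ↔ ∀ x y z : ι → Bool,
      g (fun w => x w ^^ y w ^^ z w) = fun w => g x w ^^ g y w ^^ g z w :=
  Iff.rfl

/-- The `xor` of three distinct pairs of bits is the fourth pair. -/
theorem boolProd_eq_xor_iff_of_ne {a b c : Bool × Bool} (hab : a ≠ b) (hac : a ≠ c) (hbc : b ≠ c)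
    (d : Bool × Bool) :
    d = (a.1 ^^ b.1 ^^ c.1, a.2 ^^ b.2 ^^ c.2) ↔ d ≠ a ∧ d ≠ b ∧ d ≠ c := by
  revert a b c d
  decide

/-- Every bijection of two bits is affine. -/
theorem boolProd_equiv_affine (h : Bool × Bool ≃ Bool × Bool) (a b c : Bool × Bool) :
    h (a.1 ^^ b.1 ^^ c.1, a.2 ^^ b.2 ^^ c.2) =
      ((h a).1 ^^ (h b).1 ^^ (h c).1, (h a).2 ^^ (h b).2 ^^ (h c).2) := by
  by_cases hab : a = b
  · simp [hab]
  by_cases hac : a = c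
  · simp [hac, Bool.xor_comm, Bool.xor_left_comm]
  by_cases hbc : b = c
  · simp [hbc]
  obtain ⟨ha, hb, hc⟩ := (boolProd_eq_xor_iff_of_ne hab hac hbc _).1 rfl
  exact (boolProd_eq_xor_iff_of_ne (h.injective.ne hab) (h.injective.ne hac)
    (h.injective.ne hbc) _).2 ⟨h.injective.ne ha, h.injective.ne hb, h.injective.ne hc⟩

theorem ActsOnAtMostTwoWires.mem_affinePermSubgroup {g : Equiv.Perm (Fin 3 → Bool)}
    (hg : ActsOnAtMostTwoWires g) : g ∈ affinePermSubgroup (Fin 3) := by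
  obtain ⟨i, j, h, hgh⟩ := hg
  intro x y z
  have hi (u) : g u i = (h (u i, u j)).1 := congrArg Prod.fst (hgh u).2
  have hj (u) : g u j = (h (u i, u j)).2 := congrArg Prod.snd (hgh u).2
  have key := boolProd_equiv_affine h (x i, x j) (y i, y j) (z i, z j)
  funext w
  by_cases hwi : w = i
  · subst hwi
    simp only [hi, key]
  by_cases hwj : w = j
  · subst hwj
    simp only [hj, key]
  · simp only [(hgh _).1 w hwi hwj]

theorem toffoliPerm_notMem_affinePermSubgroup :
    toffoliPerm ∉ affinePermSubgroup (Fin 3) := by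
  intro h
  have := congrFun (mem_affinePermSubgroup.1 h ![true, false, false] ![false, true, false]
    ![false, false, false]) 2
  revert this
  decide

/-- Reversible gates on at most two bits are not universal: for `n = 3` the subgroup
they generate is proper, and in particular the Toffoli gate does not belong to it. -/
theorem twoBit_gates_not_universal :
    Subgroup.closure {g : Equiv.Perm (Fin 3 → Bool) | ActsOnAtMostTwoWires g} ≠ ⊤ ∧
    toffoliPerm ∉
      Subgroup.closure {g : Equiv.Perm (Fin 3 → Bool) | ActsOnAtMostTwoWires g} := by
  have hnot : toffoliPerm ∉
      Subgroup.closure {g : Equiv.Perm (Fin 3 → Bool) | ActsOnAtMostTwoWires g} := fun h =>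
    toffoliPerm_notMem_affinePermSubgroup <|
      (Subgroup.closure_le _).2 (fun _ hg => hg.mem_affinePermSubgroup) h
  exact ⟨fun htop => hnot (htop ▸ Subgroup.mem_top _), hnot⟩
end
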